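/- Let η be a log-concave probability measure on ℝⁿ with an essentially continuous density, with potential V, and let ν = (∇V)#η be its moment measure. Then 𝒯(η, ν) = ∫ x·∇V(x) e^{-V(x)} dx = n. -/

import Mathlib

open MeasureTheory Real Set
open scoped ENNReal InnerProductSpace

noncomputable section

variable {E : Type*} [NormedAddCommGroup E] [InnerProductSpace ℝ E]

/-- `exp (-t)` for an extended-real `t`, with the convention that it is `0` at `⊤`
(proper functions never take the value `⊥`; we also set the value at `⊥` to `0`). -/
def expNeg (t : EReal) : ℝ := if t = ⊤ then 0 else if t = ⊥ then 0 else Real.exp (-t.toReal)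

/-- Convexity for extended-real-valued functions. -/
def ConvexEReal (f : E → EReal) : Prop :=
  ∀ x y : E, ∀ a b : ℝ, 0 ≤ a → 0 ≤ b → a + b = 1 →
    f (a • x + b • y) ≤ (a : EReal) * f x + (b : EReal) * f y

/-- The class `𝓕` of proper convex lower semicontinuous functions `E → ℝ ∪ {+∞}`. -/
def IsProperConvexLSC (f : E → EReal) : Prop :=
  ConvexEReal f ∧ LowerSemicontinuous f ∧ (∀ x, f x ≠ ⊥) ∧ (∃ x, f x ≠ ⊤)

/-- Fenchel-Legendre transform of an extended-real-valued function. -/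
def fenchel (f : E → EReal) (y : E) : EReal := ⨆ x : E, (⟪x, y⟫_ℝ : EReal) - f x

/-- positive part of an extended real, as `ℝ≥0∞`. -/
def ERealPos (t : EReal) : ℝ≥0∞ := if t = ⊤ then ⊤ else ENNReal.ofReal t.toReal

/-- Integral of an extended-real-valued function, with value in `EReal`. -/
def eintegral {α : Type*} [MeasurableSpace α] (μ : Measure α) (g : α → EReal) : EReal :=
  ((∫⁻ x, ERealPos (g x) ∂μ : ℝ≥0∞) : EReal) - ((∫⁻ x, ERealPos (-(g x)) ∂μ : ℝ≥0∞) : EReal)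

/-- An extended-real-valued function belongs to `L¹(μ)` : it is `μ`-a.e. finite and its
real part is integrable. -/
def MemL1 {α : Type*} [MeasurableSpace α] (μ : Measure α) (g : α → EReal) : Prop :=
  (∀ᵐ x ∂μ, g x ≠ ⊤ ∧ g x ≠ ⊥) ∧ Integrable (fun x => (g x).toReal) μ

variable [MeasurableSpace E]

/-- The maximal correlation transport cost `𝒯(μ₁, μ₂)`. -/
def mcCost (μ₁ μ₂ : Measure E) : EReal :=
  ⨅ f : {f : E → EReal // IsProperConvexLSC f},
    eintegral μ₁ f.1 + eintegral μ₂ (fenchel f.1)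


section Ray

variable {F : Type*} [NormedAddCommGroup F] [InnerProductSpace ℝ F]

/-- The gradient inequality for a convex function differentiable at `x`. -/
theorem ConvexOn.inner_gradient_le [CompleteSpace F] {D : Set F} {W : F → ℝ}
    (hW : ConvexOn ℝ D W) {x z g : F} (hx : x ∈ D) (hz : z ∈ D) (hg : HasGradientAt W g x) :
    W x + ⟪z - x, g⟫_ℝ ≤ W z := by
  have hline : HasDerivAt (fun t : ℝ => x + t • (z - x)) (z - x) 0 := by
    simpa using ((hasDerivAt_id (0 : ℝ)).smul_const (z - x)).const_add x
  have hd : HasDerivAt (fun t : ℝ => W (x + t • (z - x))) ⟪z - x, g⟫_ℝ 0 := by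
    have h1 : HasFDerivAt W (InnerProductSpace.toDual ℝ F g) (x + (0 : ℝ) • (z - x)) := by
      simpa using hg.hasFDerivAt
    have h2 := h1.comp_hasDerivAt (0 : ℝ) hline
    simpa [real_inner_comm, Function.comp_def] using h2
  have hconv : ConvexOn ℝ (Icc (0 : ℝ) 1) (fun t : ℝ => W (x + t • (z - x))) := by
    have h3 := hW.comp_affineMap (AffineMap.lineMap x z : ℝ →ᵃ[ℝ] F)
    refine (h3.subset ?_ (convex_Icc 0 1)).congr ?_
    · intro t ht
      exact hW.1.lineMap_mem hx hz ht
    · intro t _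
      simp [AffineMap.lineMap_apply, add_comm]
  have h4 := hconv.le_slope_of_hasDerivAt (x := 0) (y := 1) (by simp) (by simp) one_pos hd
  simp [slope_def_field] at h4
  linarith

/-- Continuity along the ray through `x` of a log-concave function that vanishes outside the
interior of its domain. -/
theorem continuousAt_ray [FiniteDimensional ℝ F] {D : Set F} {W φ : F → ℝ} (hW : ConvexOn ℝ D W)
    (hφD : ∀ z ∈ D, φ z = Real.exp (-W z)) (hφ0 : ∀ z, 0 ≤ φ z) (hφ : UpperSemicontinuous φ)
    {x : F} {u : ℝ} (hb : u • x ∉ interior D → φ (u • x) = 0) :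
    ContinuousAt (fun t : ℝ => φ (t • x)) u := by
  have hray : Continuous fun t : ℝ => t • x := by fun_prop
  by_cases hu : u • x ∈ interior D
  · have h1 : ContinuousAt (fun z => Real.exp (-W z)) (u • x) :=
      ((hW.continuousOn_interior.continuousAt (isOpen_interior.mem_nhds hu)).neg).rexp
    have h2 : ContinuousAt φ (u • x) := by
      refine h1.congr ?_
      filter_upwards [isOpen_interior.mem_nhds hu] with z hz
      exact (hφD z (interior_subset hz)).symm
    exact ContinuousAt.comp (f := fun t : ℝ => t • x) h2 hray.continuousAt
  · have h0 := hb hu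
    rw [ContinuousAt, h0]
    refine tendsto_order.2 ⟨fun a ha => ?_, fun a ha => ?_⟩
    · exact Filter.Eventually.of_forall fun t => ha.trans_le (hφ0 _)
    · exact hray.continuousAt.eventually (hφ (u • x) a (by simpa [h0] using ha))

/-- Right derivative along a ray of a log-concave function, with the bound on the logarithmic
derivative given by the oscillation of the potential. -/
theorem hasDerivWithinAt_ray {D : Set F} {W φ : F → ℝ} (hW : ConvexOn ℝ D W)
    (hφD : ∀ z ∈ D, φ z = Real.exp (-W z)) (hφ0 : ∀ z, z ∉ D → φ z = 0)
    (h0 : (0 : F) ∈ interior D) {M : ℝ} (hM : ∀ z ∈ D, W 0 - M ≤ W z)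
    {x : F} {u : ℝ} (hu : 0 < u) (hb : u • x ∉ interior D → φ (u • x) = 0) :
    ∃ r : ℝ, 0 ≤ u * r + M ∧
      HasDerivWithinAt (fun t : ℝ => φ (t • x)) (-(r * φ (u • x))) (Ioi u) u ∧
      ∀ [CompleteSpace F] (g : F), (u • x ∈ interior D → HasGradientAt W g (u • x)) →
        (u * r + M) * φ (u • x) = (⟪u • x, g⟫_ℝ + M) * φ (u • x) := by
  have hM0 : 0 ≤ M := by linarith [hM 0 (interior_subset h0)]
  have hray : Continuous fun t : ℝ => t • x := by fun_prop
  by_cases hx : u • x ∈ interior D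
  · set S : Set ℝ := (fun t : ℝ => t • x) ⁻¹' D with hS
    have hconv : ConvexOn ℝ S (fun t : ℝ => W (t • x)) := by
      have h3 := hW.comp_affineMap (LinearMap.toSpanSingleton ℝ F x).toAffineMap
      exact h3
    have huS : u ∈ interior S :=
      preimage_interior_subset_interior_preimage hray hx
    have h0S : (0 : ℝ) ∈ S := by simpa [hS] using interior_subset h0
    set r := derivWithin (fun t : ℝ => W (t • x)) (Ioi u) u with hr
    have hder := hconv.hasDerivWithinAt_rightDeriv_of_mem_interior huS
    refine ⟨r, ?_, ?_, ?_⟩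
    · have hl : slope (fun t : ℝ => W (t • x)) 0 u ≤ r :=
        (hconv.slope_le_leftDeriv h0S (interior_subset huS) hu
          (hconv.differentiableWithinAt_Iio_of_mem_interior huS)).trans
          (hconv.leftDeriv_le_rightDeriv_of_mem_interior huS)
      have h1 := hM _ (interior_subset hx)
      simp only [slope_def_field, zero_smul, sub_zero] at hl
      rw [div_le_iff₀ hu] at hl
      linarith
    · have h1 : HasDerivWithinAt (fun t : ℝ => Real.exp (-W (t • x)))
          (Real.exp (-W (u • x)) * (-r)) (Ioi u) u := hder.neg.exp
      have h2 : (-(r * φ (u • x))) = Real.exp (-W (u • x)) * (-r) := by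
        rw [hφD _ (interior_subset hx)]; ring
      rw [h2]
      refine h1.congr_of_eventuallyEq ?_ (hφD _ (interior_subset hx))
      refine nhdsWithin_le_nhds ?_
      filter_upwards [mem_interior_iff_mem_nhds.1 huS] with t ht
      exact hφD _ ht
    · intro _ g hg
      have h1 : HasDerivAt (fun t : ℝ => W (t • x)) ⟪x, g⟫_ℝ u := by
        have h2 := (hg hx).hasFDerivAt.comp_hasDerivAt u ((hasDerivAt_id u).smul_const x)
        simpa [real_inner_comm, Function.comp_def] using h2
      have h2 : r = ⟪x, g⟫_ℝ := h1.hasDerivWithinAt.derivWithin (uniqueDiffWithinAt_Ioi u)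
      rw [h2, real_inner_smul_left]
  · have hφu := hb hx
    refine ⟨0, by simpa using hM0, ?_, fun g _ => by simp [hφu]⟩
    have hz : ∀ t ∈ Ioi u, φ (t • x) = 0 := by
      intro t ht
      refine hφ0 _ fun htD => hx ?_
      have ht0 : 0 < t := hu.trans ht
      have hlt : u / t < 1 := (div_lt_one ht0).2 ht
      have := hW.1.combo_interior_self_mem_interior h0 htD (a := 1 - u / t) (b := u / t)
        (by linarith) (by positivity) (by ring)
      simpa [smul_smul, div_mul_cancel₀ _ ht0.ne'] using this
    have := (hasDerivWithinAt_const u (Ioi u) (0 : ℝ)).congr (f₁ := fun t : ℝ => φ (t • x)) hz hφu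
    simpa [hφu] using this

/-- Fundamental theorem of calculus along a ray. -/
theorem lintegral_ray [FiniteDimensional ℝ F] {D : Set F} {W φ : F → ℝ} (hW : ConvexOn ℝ D W)
    (hφD : ∀ z ∈ D, φ z = Real.exp (-W z)) (hφ0 : ∀ z, z ∉ D → φ z = 0)
    (hφ : UpperSemicontinuous φ) (h0 : (0 : F) ∈ interior D) {M : ℕ}
    (hM : ∀ z ∈ D, W 0 - M ≤ W z) (g : F → F) {x : F}
    (hb : ∀ u : ℝ, 0 < u → u • x ∉ interior D → φ (u • x) = 0)
    (hg : ∀ᵐ u : ℝ ∂volume.restrict (Ioc 1 2), u • x ∈ interior D →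
      HasGradientAt W (g (u • x)) (u • x)) :
    ENNReal.ofReal ((2 ^ M)⁻¹ * φ ((2 : ℝ) • x)) +
      ∫⁻ u in Ioc (1 : ℝ) 2, ENNReal.ofReal ((u ^ (M + 1))⁻¹) *
        ENNReal.ofReal ((⟪u • x, g (u • x)⟫_ℝ + M) * φ (u • x)) = ENNReal.ofReal (φ x) := by
  have hφnn : ∀ z, 0 ≤ φ z := fun z => by
    by_cases hz : z ∈ D
    · rw [hφD z hz]; positivity
    · rw [hφ0 z hz]
  choose! r hr1 hr2 hr3 using fun (u : ℝ) (hu : 0 < u) =>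
    hasDerivWithinAt_ray hW hφD hφ0 h0 hM hu (hb u hu)
  set k : ℝ → ℝ := fun u => -((u ^ M)⁻¹ * φ (u • x)) with hk
  set k' : ℝ → ℝ := fun u => (u ^ (M + 1))⁻¹ * ((u * r u + M) * φ (u • x)) with hk'
  have hcont : ContinuousOn k (Icc 1 2) := by
    intro u hu
    have hu0 : 0 < u := one_pos.trans_le hu.1
    have h1 := continuousAt_ray hW hφD hφnn hφ (hb u hu0)
    exact (((continuousAt_id.pow M).inv₀ (pow_ne_zero _ hu0.ne')).mul h1).neg.continuousWithinAt
  have hder : ∀ u ∈ Ioo (1 : ℝ) 2, HasDerivWithinAt k (k' u) (Ioi u) u := by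
    intro u hu
    have hu0 : 0 < u := one_pos.trans hu.1
    have h1 : HasDerivWithinAt (fun u : ℝ => (u ^ M)⁻¹) (-(M * u ^ (M - 1)) / (u ^ M) ^ 2)
        (Ioi u) u := ((hasDerivAt_pow M u).inv (pow_ne_zero _ hu0.ne')).hasDerivWithinAt
    have h2 := (h1.mul (hr2 u hu0)).neg
    refine HasDerivWithinAt.congr_deriv (f := k) h2 ?_
    simp only [hk']
    rcases M with _ | m
    · field_simp
      simp only [Nat.cast_zero]
      ring
    · simp only [Nat.add_sub_cancel]
      field_simp
      ring
  have hnn : ∀ u ∈ Ioo (1 : ℝ) 2, 0 ≤ k' u := by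
    intro u hu
    have hu0 : 0 < u := one_pos.trans hu.1
    exact mul_nonneg (by positivity) (mul_nonneg (hr1 u hu0) (hφnn _))
  have h_int := intervalIntegral.integrableOn_deriv_right_of_nonneg hcont hder hnn
  have hFTC := intervalIntegral.integral_eq_sub_of_hasDeriv_right_of_le one_le_two hcont hder
    ((intervalIntegrable_iff_integrableOn_Ioc_of_le one_le_two).2 h_int)
  rw [intervalIntegral.integral_of_le one_le_two] at hFTC
  have hnn' : 0 ≤ᵐ[volume.restrict (Ioc (1 : ℝ) 2)] k' := by
    rw [← Measure.restrict_congr_set Ioo_ae_eq_Ioc]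
    filter_upwards [ae_restrict_mem measurableSet_Ioo] with u hu using hnn u hu
  have hl := ofReal_integral_eq_lintegral_ofReal h_int hnn'
  have hcongr : ∫⁻ u in Ioc (1 : ℝ) 2, ENNReal.ofReal ((u ^ (M + 1))⁻¹) *
        ENNReal.ofReal ((⟪u • x, g (u • x)⟫_ℝ + M) * φ (u • x)) =
      ∫⁻ u in Ioc (1 : ℝ) 2, ENNReal.ofReal (k' u) := by
    refine lintegral_congr_ae ?_
    filter_upwards [hg, ae_restrict_mem measurableSet_Ioc] with u hgu hu
    have hu0 : 0 < u := one_pos.trans hu.1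
    rw [← hr3 u hu0 (g (u • x)) hgu, ← ENNReal.ofReal_mul (by positivity)]
  rw [hcongr, ← hl, ← ENNReal.ofReal_add (mul_nonneg (by positivity) (hφnn _))
    (integral_nonneg_of_ae hnn'), hFTC]
  simp [hk]

end Ray

section Core

variable {F : Type*} [NormedAddCommGroup F] [InnerProductSpace ℝ F] [FiniteDimensional ℝ F]
  [MeasurableSpace F] [BorelSpace F]

theorem lintegral_comp_smul_of_pos {f : F → ℝ≥0∞} (hf : Measurable f) {u : ℝ} (hu : 0 < u) :
    ∫⁻ x, f (u • x) = ENNReal.ofReal ((u ^ Module.finrank ℝ F)⁻¹) * ∫⁻ x, f x := by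
  rw [← lintegral_map hf (measurable_const_smul u), Measure.map_addHaar_smul _ hu.ne',
    lintegral_smul_measure, abs_of_pos (by positivity), smul_eq_mul]

theorem ae_ae_smul {p : F → Prop} (hp : ∀ᵐ x, p x) :
    ∀ᵐ x : F, ∀ᵐ u : ℝ ∂volume.restrict (Ioc 1 2), p (u • x) := by
  set N := toMeasurable volume {x : F | ¬ p x} with hN
  have hN0 : volume N = 0 := by rw [hN, measure_toMeasurable]; exact hp
  have hNm : MeasurableSet N := measurableSet_toMeasurable _ _
  have hmeas : MeasurableSet {q : F × ℝ | q.2 • q.1 ∉ N} :=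
    ((measurable_snd.smul measurable_fst) hNm).compl
  have h1 : ∀ᵐ u : ℝ ∂volume.restrict (Ioc 1 2), ∀ᵐ x : F, u • x ∉ N := by
    filter_upwards [ae_restrict_mem measurableSet_Ioc] with u hu
    have hu0 : u ≠ 0 := (one_pos.trans hu.1).ne'
    rw [ae_iff]
    simp only [not_not]
    have := Measure.addHaar_preimage_smul (volume : Measure F) hu0 N
    rw [hN0, mul_zero] at this
    exact this
  have h2 := (Measure.ae_ae_comm (μ := volume.restrict (Ioc (1 : ℝ) 2)) (ν := (volume : Measure F))
    (p := fun u x => u • x ∉ N) ((measurable_fst.smul measurable_snd) hNm).compl).1 h1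
  filter_upwards [h2] with x hx
  filter_upwards [hx] with u hu
  by_contra hpu
  exact hu (subset_toMeasurable _ _ hpu)

theorem lintegral_inv_pow (k : ℕ) :
    ∫⁻ u in Ioc (1 : ℝ) 2, ENNReal.ofReal ((u ^ (k + 2))⁻¹) =
      ENNReal.ofReal ((1 - (2 ^ (k + 1))⁻¹) / (k + 1)) := by
  have hcont : ContinuousOn (fun u : ℝ => (u ^ (k + 2))⁻¹) (uIcc 1 2) := by
    intro u hu
    rw [uIcc_of_le one_le_two] at hu
    have hu0 : u ≠ 0 := (one_pos.trans_le hu.1).ne'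
    exact ((continuousAt_id.pow _).inv₀ (pow_ne_zero _ hu0)).continuousWithinAt
  have h_int := hcont.intervalIntegrable (μ := volume)
  rw [← ofReal_integral_eq_lintegral_ofReal
    ((intervalIntegrable_iff_integrableOn_Ioc_of_le one_le_two).1 h_int),
    ← intervalIntegral.integral_of_le one_le_two]
  · congr 1
    have hder : ∀ u ∈ uIcc (1 : ℝ) 2,
        HasDerivAt (fun u : ℝ => -(u ^ (k + 1))⁻¹ / (k + 1)) ((u ^ (k + 2))⁻¹) u := by
      intro u hu
      rw [uIcc_of_le one_le_two] at hu
      have hu0 : u ≠ 0 := (one_pos.trans_le hu.1).ne'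
      have h1 := (((hasDerivAt_pow (k + 1) u).inv (pow_ne_zero _ hu0)).neg).div_const ((k : ℝ) + 1)
      refine HasDerivAt.congr_deriv (f := fun u : ℝ => -(u ^ (k + 1))⁻¹ / (k + 1)) h1 ?_
      push_cast
      have : (k : ℝ) + 1 ≠ 0 := by positivity
      field_simp
      ring
    rw [intervalIntegral.integral_eq_sub_of_hasDerivAt hder h_int]
    simp
    ring
  · filter_upwards [ae_restrict_mem measurableSet_Ioc] with u hu
    have hu0 : 0 < u := one_pos.trans hu.1
    simp only [Pi.zero_apply]
    positivity

/-- The radial integration by parts for a log-concave function whose boundary values vanish along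
almost every ray. -/
theorem lintegral_radial {D : Set F} {W φ : F → ℝ} (hW : ConvexOn ℝ D W)
    (hφD : ∀ z ∈ D, φ z = Real.exp (-W z)) (hφ0 : ∀ z, z ∉ D → φ z = 0)
    (hφ : UpperSemicontinuous φ) (h0 : (0 : F) ∈ interior D) {M : ℕ} (hM1 : 1 ≤ M)
    (hM : ∀ z ∈ D, W 0 - M ≤ W z) {g : F → F} (hgm : Measurable g)
    (hb : ∀ᵐ x : F, ∀ u : ℝ, 0 < u → u • x ∉ interior D → φ (u • x) = 0)
    (hg : ∀ᵐ z : F, z ∈ interior D → HasGradientAt W (g z) z)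
    (hfin : ∫⁻ x, ENNReal.ofReal (φ x) ≠ ∞) :
    ∫⁻ x, ENNReal.ofReal ((⟪x, g x⟫_ℝ + M) * φ x) =
      ENNReal.ofReal (Module.finrank ℝ F + M) * ∫⁻ x, ENNReal.ofReal (φ x) := by
  have hφm : Measurable φ := hφ.measurable
  set G : F → ℝ≥0∞ := fun x => ENNReal.ofReal ((⟪x, g x⟫_ℝ + M) * φ x) with hG
  have hGm : Measurable G := by
    refine ENNReal.measurable_ofReal.comp (Measurable.mul ?_ hφm)
    exact (measurable_id.inner hgm).add_const _
  set d := Module.finrank ℝ F with hd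
  obtain ⟨m, rfl⟩ : ∃ m, M = m + 1 := ⟨M - 1, by omega⟩
  have hray : ∀ᵐ x : F, ENNReal.ofReal ((2 ^ (m + 1))⁻¹) * ENNReal.ofReal (φ ((2 : ℝ) • x)) +
      ∫⁻ u in Ioc (1 : ℝ) 2, ENNReal.ofReal ((u ^ (m + 1 + 1))⁻¹) * G (u • x) =
        ENNReal.ofReal (φ x) := by
    filter_upwards [hb, ae_ae_smul hg] with x hbx hgx
    rw [← ENNReal.ofReal_mul (by positivity)]
    exact lintegral_ray hW hφD hφ0 hφ h0 hM g hbx hgx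
  have hφm' : Measurable fun x => ENNReal.ofReal (φ x) := ENNReal.measurable_ofReal.comp hφm
  have htot := lintegral_congr_ae hray
  have hswap : ∫⁻ x : F, ∫⁻ u in Ioc (1 : ℝ) 2, ENNReal.ofReal ((u ^ (m + 1 + 1))⁻¹) * G (u • x) =
      ENNReal.ofReal ((1 - (2 ^ (m + d + 1))⁻¹) / ((m + d : ℕ) + 1)) * ∫⁻ x, G x := by
    rw [lintegral_lintegral_swap]
    · have h1 : ∀ u ∈ Ioc (1 : ℝ) 2,
          ∫⁻ x, ENNReal.ofReal ((u ^ (m + 1 + 1))⁻¹) * G (u • x) =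
            ENNReal.ofReal ((u ^ (m + d + 2))⁻¹) * ∫⁻ x, G x := by
        intro u hu
        have hu0 : 0 < u := one_pos.trans hu.1
        have hGu : Measurable fun x => G (u • x) := hGm.comp (measurable_const_smul u)
        rw [lintegral_const_mul _ hGu,
          lintegral_comp_smul_of_pos hGm hu0, ← mul_assoc, ← ENNReal.ofReal_mul (by positivity)]
        congr 3
        rw [← mul_inv, ← pow_add]
        congr 2
        omega
      rw [setLIntegral_congr_fun measurableSet_Ioc h1, lintegral_mul_const _ (by fun_prop),
        lintegral_inv_pow]
    · refine Measurable.aemeasurable ?_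
      have : Measurable fun q : F × ℝ => G (q.2 • q.1) :=
        hGm.comp (measurable_snd.smul measurable_fst)
      exact Measurable.mul (by fun_prop) this
  rw [lintegral_add_left (by fun_prop), lintegral_const_mul _ (by fun_prop),
    lintegral_comp_smul_of_pos hφm' two_pos, hswap, ← mul_assoc,
    ← ENNReal.ofReal_mul (by positivity)] at htot
  set I := ∫⁻ x, ENNReal.ofReal (φ x) with hI
  set J := ∫⁻ x, G x with hJ
  have hq : ((2 : ℝ) ^ (m + 1))⁻¹ * (2 ^ d)⁻¹ = (2 ^ (m + d + 1))⁻¹ := by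
    rw [← mul_inv, ← pow_add]; congr 2; omega
  rw [hq] at htot
  have hqlt : ((2 : ℝ) ^ (m + d + 1))⁻¹ < 1 :=
    inv_lt_one_of_one_lt₀ (one_lt_pow₀ one_lt_two (by omega))
  set q : ℝ := ((2 : ℝ) ^ (m + d + 1))⁻¹ with hqd
  have hq0 : 0 ≤ q := by positivity
  have hc0 : 0 < (1 - q) / ((m + d : ℕ) + 1) := by
    have : 0 < 1 - q := by linarith
    positivity
  have hcJ : ENNReal.ofReal ((1 - q) / ((m + d : ℕ) + 1)) * J = ENNReal.ofReal (1 - q) * I := by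
    have h1 : ENNReal.ofReal q * I + ENNReal.ofReal (1 - q) * I = I := by
      rw [← add_mul, ← ENNReal.ofReal_add hq0 (by linarith)]; simp
    have h2 : ENNReal.ofReal q * I ≠ ∞ := ENNReal.mul_ne_top ENNReal.ofReal_ne_top hfin
    exact (ENNReal.add_right_inj h2).1 (htot.trans h1.symm)
  have hinv : ENNReal.ofReal ((d : ℝ) + ((m + 1 : ℕ) : ℝ)) *
      ENNReal.ofReal ((1 - q) / ((m + d : ℕ) + 1)) = ENNReal.ofReal (1 - q) := by
    rw [← ENNReal.ofReal_mul (by positivity)]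
    congr 1
    push_cast
    field_simp
    ring
  refine (ENNReal.mul_right_inj (ENNReal.ofReal_pos.2 hc0).ne' ENNReal.ofReal_ne_top).1 ?_
  rw [hcJ, ← hinv]
  ring

end Core

section Cone

/-- The central projection of the half-spaces `x i ≠ 0` onto the hyperplane `x i = 1`. -/
def centralProj {m : ℕ} (i : Fin (m + 1)) (x : EuclideanSpace ℝ (Fin (m + 1))) : Fin m → ℝ :=
  fun j => x (i.succAbove j) / x i

theorem centralProj_smul {m : ℕ} (i : Fin (m + 1)) (x : EuclideanSpace ℝ (Fin (m + 1))) {u : ℝ}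
    (hu : u ≠ 0) : centralProj i (u • x) = centralProj i x := by
  ext j
  simp [centralProj, mul_div_mul_left _ _ hu]

theorem volume_centralProj_image {m : ℕ} (i : Fin (m + 1))
    {B : Set (EuclideanSpace ℝ (Fin (m + 1)))} (hB : μH[m] B = 0) :
    volume (centralProj i '' (B ∩ {x | x i ≠ 0})) = 0 := by
  have hloc : ∀ x ∈ B ∩ {x | x i ≠ 0}, ∃ u ∈ nhdsWithin x (B ∩ {x | x i ≠ 0}),
      OuterMeasure.comap (centralProj i)
        (volume : Measure (Fin m → ℝ)).toOuterMeasure u = 0 := by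
    intro x hx
    have hc : ContDiffAt ℝ 1 (centralProj i) x := by
      refine contDiffAt_pi.2 fun j => ContDiffAt.div ?_ ?_ hx.2 <;> fun_prop
    obtain ⟨K, t, ht, hK⟩ := hc.exists_lipschitzOnWith
    refine ⟨t ∩ (B ∩ {x | x i ≠ 0}), Filter.inter_mem (mem_nhdsWithin_of_mem_nhds ht)
      self_mem_nhdsWithin, ?_⟩
    have hK' := (hK.mono (inter_subset_left (t := B ∩ {x | x i ≠ 0}))).hausdorffMeasure_image_le
      (d := m) (by positivity)
    have hz : μH[m] (t ∩ (B ∩ {x | x i ≠ 0})) = 0 :=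
      measure_mono_null (fun y hy => hy.2.1) hB
    rw [hz, mul_zero] at hK'
    have hvol : (μH[(m : ℝ)] : Measure (Fin m → ℝ)) = volume := by
      simpa using hausdorffMeasure_pi_real (ι := Fin m)
    rw [hvol] at hK'
    simpa using hK'
  simpa using measure_null_of_locally_null _ hloc

theorem volume_preimage_centralProj {m : ℕ} (i : Fin (m + 1)) {Z : Set (Fin m → ℝ)}
    (hZ : volume Z = 0) :
    volume {x : EuclideanSpace ℝ (Fin (m + 1)) | x i ≠ 0 ∧ centralProj i x ∈ Z} = 0 := by
  set T := toMeasurable volume Z with hT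
  have hT0 : volume T = 0 := by rw [hT, measure_toMeasurable]; exact hZ
  have hTm : MeasurableSet T := measurableSet_toMeasurable _ _
  set S : Set (ℝ × (Fin m → ℝ)) := {q | q.1 ≠ 0 ∧ q.1⁻¹ • q.2 ∈ T} with hS
  have hSm : MeasurableSet S := by
    have h1 : Measurable fun q : ℝ × (Fin m → ℝ) => q.1⁻¹ • q.2 :=
      measurable_fst.inv.smul measurable_snd
    exact ((measurableSet_singleton (0 : ℝ)).compl.preimage measurable_fst).inter (h1 hTm)
  have hS0 : volume S = 0 := by
    rw [Measure.volume_eq_prod, Measure.measure_prod_null hSm]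
    refine Filter.Eventually.of_forall fun t => ?_
    by_cases ht : t = 0
    · simp [hS, ht]
    · have h2 := Measure.addHaar_preimage_smul (volume : Measure (Fin m → ℝ)) (inv_ne_zero ht) T
      rw [hT0, mul_zero] at h2
      exact measure_mono_null (fun y hy => hy.2) h2
  have hmp := (volume_preserving_piFinSuccAbove (fun _ : Fin (m + 1) => ℝ) i).comp
    (PiLp.volume_preserving_ofLp (Fin (m + 1)))
  refine measure_mono_null ?_ ((hmp.measure_preimage hSm.nullMeasurableSet).trans hS0)
  intro x hx
  refine ⟨hx.1, subset_toMeasurable _ _ ?_⟩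
  convert hx.2 using 1
  ext j
  simp [centralProj, div_eq_inv_mul, MeasurableEquiv.piFinSuccAbove, Fin.insertNthEquiv,
    Fin.removeNth]

/-- Almost every ray avoids a set of vanishing codimension-one Hausdorff measure. -/
theorem ae_forall_smul_notMem {m : ℕ} {B : Set (EuclideanSpace ℝ (Fin (m + 1)))}
    (hB : μH[m] B = 0) :
    ∀ᵐ x : EuclideanSpace ℝ (Fin (m + 1)), ∀ u : ℝ, 0 < u → u • x ∉ B := by
  have h1 : ∀ᵐ x : EuclideanSpace ℝ (Fin (m + 1)), ∀ i : Fin (m + 1),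
      ¬ (x i ≠ 0 ∧ centralProj i x ∈ centralProj i '' (B ∩ {x | x i ≠ 0})) := by
    refine ae_all_iff.2 fun i => ?_
    rw [ae_iff]
    simpa only [not_not] using volume_preimage_centralProj i (volume_centralProj_image i hB)
  have h2 : ∀ᵐ x : EuclideanSpace ℝ (Fin (m + 1)), x ≠ 0 := by
    simp [ae_iff]
  filter_upwards [h1, h2] with x hx hx0 u hu hux
  obtain ⟨i, hi⟩ : ∃ i, x i ≠ 0 := by
    by_contra! h
    exact hx0 (by ext i; simpa using h i)
  exact hx i ⟨hi, u • x, ⟨hux, by simp [hu.ne', hi]⟩, centralProj_smul i x hu.ne'⟩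

end Cone

section Coercive

variable {F : Type*} [NormedAddCommGroup F] [InnerProductSpace ℝ F]

theorem ConvexOn.exists_ball_le [FiniteDimensional ℝ F] {D : Set F} {W : F → ℝ} (hW : ConvexOn ℝ D W)
    {x₀ : F}
    (hx₀ : x₀ ∈ interior D) :
    ∃ r > 0, ∃ c : ℝ, Metric.ball x₀ r ⊆ D ∧ ∀ z ∈ Metric.ball x₀ r, W z ≤ c := by
  have h1 : ∀ᶠ z in nhds x₀, W z < W x₀ + 1 :=
    (hW.continuousOn_interior.continuousAt (isOpen_interior.mem_nhds hx₀)).eventually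
      (gt_mem_nhds (by linarith))
  obtain ⟨r, hr, h⟩ := Metric.eventually_nhds_iff_ball.1
    (h1.and (mem_interior_iff_mem_nhds.1 hx₀))
  exact ⟨r, hr, W x₀ + 1, fun z hz => (h z hz).2, fun z hz => (h z hz).1.le⟩

/-- The homothetic images of a ball contained in the domain have controlled values. -/
theorem ConvexOn.le_on_ball {D : Set F} {W : F → ℝ} (hW : ConvexOn ℝ D W) {x₀ : F} {r c : ℝ}
    (hr : 0 < r) (hball : Metric.ball x₀ r ⊆ D) (hc : ∀ z ∈ Metric.ball x₀ r, W z ≤ c) {z : F}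
    (hz : z ∈ D) {s : ℝ} (hs0 : 0 ≤ s) (hs : s ≤ 1 / 2) {y : F}
    (hy : y ∈ Metric.ball (x₀ + s • (z - x₀)) (r / 2)) :
    y ∈ D ∧ W y ≤ s * W z + (1 - s) * c := by
  have hs1 : 0 < 1 - s := by linarith
  set b : F := x₀ + (1 - s)⁻¹ • (y - (x₀ + s • (z - x₀))) with hb
  have hbr : b ∈ Metric.ball x₀ r := by
    rw [Metric.mem_ball, dist_eq_norm] at hy ⊢
    rw [hb, add_sub_cancel_left, norm_smul, Real.norm_of_nonneg (by positivity),
      inv_mul_lt_iff₀ hs1]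
    nlinarith
  have hyb : y = s • z + (1 - s) • b := by
    rw [hb, smul_add, smul_inv_smul₀ hs1.ne']
    module
  rw [hyb]
  refine ⟨hW.1 hz (hball hbr) hs0 hs1.le (by ring), ?_⟩
  refine (hW.2 hz (hball hbr) hs0 hs1.le (by ring)).trans ?_
  simp only [smul_eq_mul]
  gcongr
  exact hc b hbr

variable [FiniteDimensional ℝ F] [MeasurableSpace F] [BorelSpace F]

theorem measure_mul_exp_le {D : Set F} {W φ : F → ℝ} (hφD : ∀ z ∈ D, φ z = Real.exp (-W z))
    {S : Set F} (hS : MeasurableSet S) {t : ℝ} (h : ∀ y ∈ S, y ∈ D ∧ W y ≤ t) :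
    ENNReal.ofReal (Real.exp (-t)) * volume S ≤ ∫⁻ x, ENNReal.ofReal (φ x) := by
  calc ENNReal.ofReal (Real.exp (-t)) * volume S = ∫⁻ _ in S, ENNReal.ofReal (Real.exp (-t)) := by
        rw [setLIntegral_const]
    _ ≤ ∫⁻ x in S, ENNReal.ofReal (φ x) := by
        refine setLIntegral_mono' hS fun y hy => ENNReal.ofReal_le_ofReal ?_
        rw [hφD y (h y hy).1]
        exact Real.exp_le_exp.2 (neg_le_neg (h y hy).2)
    _ ≤ _ := setLIntegral_le_lintegral _ _

/-- The potential of an integrable log-concave function is bounded below. -/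
theorem ConvexOn.exists_le_of_lintegral_exp {D : Set F} {W φ : F → ℝ} (hW : ConvexOn ℝ D W)
    (hφD : ∀ z ∈ D, φ z = Real.exp (-W z)) (hfin : ∫⁻ x, ENNReal.ofReal (φ x) ≠ ∞) {x₀ : F}
    (hx₀ : x₀ ∈ interior D) : ∃ m : ℝ, ∀ z ∈ D, m ≤ W z := by
  obtain ⟨r, hr, c, hball, hc⟩ := hW.exists_ball_le hx₀
  set v := (volume (Metric.ball (0 : F) (r / 2))).toReal with hv
  have hvtop : volume (Metric.ball (0 : F) (r / 2)) ≠ ∞ := measure_ball_lt_top.ne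
  have hv0 : 0 < v := ENNReal.toReal_pos (Metric.measure_ball_pos _ _ (by positivity)).ne' hvtop
  set I := (∫⁻ x, ENNReal.ofReal (φ x)).toReal with hI
  refine ⟨2 - 2 * (I / v) - c, fun z hz => ?_⟩
  have h1 := measure_mul_exp_le hφD (S := Metric.ball (x₀ + (1 / 2 : ℝ) • (z - x₀)) (r / 2))
    Metric.isOpen_ball.measurableSet
    (fun y hy => hW.le_on_ball hr hball hc hz (by norm_num) le_rfl hy)
  rw [Measure.addHaar_ball_center] at h1
  have h2 := ENNReal.toReal_mono hfin h1
  rw [ENNReal.toReal_mul, ENNReal.toReal_ofReal (Real.exp_pos _).le] at h2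
  have h3 := Real.add_one_le_exp (-(1 / 2 * W z + (1 - 1 / 2) * c))
  have h4 := (le_div_iff₀ hv0).2 h2
  linarith

/-- A sublevel set of the potential of an integrable log-concave function is bounded. -/
theorem ConvexOn.exists_norm_lt_of_lintegral_exp {D : Set F} {W φ : F → ℝ} (hW : ConvexOn ℝ D W)
    (hφD : ∀ z ∈ D, φ z = Real.exp (-W z)) (hfin : ∫⁻ x, ENNReal.ofReal (φ x) ≠ ∞) {x₀ : F}
    (hx₀ : x₀ ∈ interior D) (t : ℝ) : ∃ R > 0, ∀ z ∈ D, W z ≤ t → ‖z - x₀‖ < R := by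
  obtain ⟨r, hr, c, hball, hc⟩ := hW.exists_ball_le hx₀
  by_contra! hcon
  set T := max t c with hT
  set v := ENNReal.ofReal (Real.exp (-T)) * volume (Metric.ball (0 : F) (r / 2)) with hv
  have hv0 : v ≠ 0 := mul_ne_zero (ENNReal.ofReal_pos.2 (Real.exp_pos _)).ne'
    (Metric.measure_ball_pos _ _ (by positivity)).ne'
  have hN : ∀ N : ℕ, (N : ℝ≥0∞) * v ≤ ∫⁻ x, ENNReal.ofReal (φ x) := by
    intro N
    rcases Nat.eq_zero_or_pos N with rfl | hNpos
    · simp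
    have hN0 : (0 : ℝ) < N := by exact_mod_cast hNpos
    obtain ⟨z, hz, hzt, hzR⟩ := hcon (2 * N * r) (by positivity)
    set p : ℕ → F := fun k => x₀ + ((k : ℝ) / (2 * N)) • (z - x₀) with hp
    have hdisj : Pairwise fun k l : ℕ =>
        Disjoint (Metric.ball (p k) (r / 2)) (Metric.ball (p l) (r / 2)) := by
      intro k l hkl
      refine Metric.ball_disjoint_ball ?_
      have h1 : p k - p l = (((k : ℝ) - l) / (2 * N)) • (z - x₀) := by
        simp only [hp]
        rw [sub_div, sub_smul]
        abel
      have h2 : (1 : ℝ) ≤ |(k : ℝ) - l| := by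
        have : (1 : ℤ) ≤ |(k : ℤ) - l| := Int.one_le_abs (by omega)
        exact_mod_cast this
      rw [dist_eq_norm, h1, norm_smul, Real.norm_eq_abs, abs_div,
        abs_of_pos (by positivity : (0 : ℝ) < 2 * N), add_halves, div_mul_eq_mul_div,
        le_div_iff₀ (by positivity)]
      nlinarith [norm_nonneg (z - x₀)]
    have h3 := measure_mul_exp_le hφD (t := T)
      (S := ⋃ k ∈ Finset.range N, Metric.ball (p k) (r / 2))
      (Finset.measurableSet_biUnion _ fun _ _ => Metric.isOpen_ball.measurableSet) ?_
    · rw [measure_biUnion_finset (fun k _ l _ hkl => hdisj hkl)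
        (fun _ _ => Metric.isOpen_ball.measurableSet)] at h3
      simp only [Measure.addHaar_ball_center, Finset.sum_const, Finset.card_range,
        nsmul_eq_mul] at h3
      rw [hv]
      calc _ = _ := by ring
        _ ≤ _ := h3
    · intro y hy
      obtain ⟨k, hk, hyk⟩ := mem_iUnion₂.1 hy
      have hkN : (k : ℝ) ≤ N := by exact_mod_cast (Finset.mem_range.1 hk).le
      have hs : (k : ℝ) / (2 * N) ≤ 1 / 2 := by
        rw [div_le_div_iff₀ (by positivity) two_pos]
        linarith
      have hs0 : 0 ≤ (k : ℝ) / (2 * N) := by positivity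
      obtain ⟨hyD, hyW⟩ := hW.le_on_ball hr hball hc hz hs0 hs hyk
      refine ⟨hyD, hyW.trans ?_⟩
      nlinarith [le_max_left t c, le_max_right t c]
  obtain ⟨N, hlt⟩ := ENNReal.exists_nat_mul_gt hv0 hfin
  exact (hN N).not_gt hlt

/-- The potential of an integrable log-concave function grows at least linearly. -/
theorem ConvexOn.exists_norm_le_of_lintegral_exp {D : Set F} {W φ : F → ℝ} (hW : ConvexOn ℝ D W)
    (hφD : ∀ z ∈ D, φ z = Real.exp (-W z)) (hfin : ∫⁻ x, ENNReal.ofReal (φ x) ≠ ∞) {x₀ : F}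
    (hx₀ : x₀ ∈ interior D) : ∃ R > 0, ∀ z ∈ D, ‖z - x₀‖ ≤ R * (1 + |W z - W x₀|) := by
  obtain ⟨R, hR, hlt⟩ := hW.exists_norm_lt_of_lintegral_exp hφD hfin hx₀ (W x₀ + 1)
  refine ⟨R, hR, fun z hz => ?_⟩
  rcases le_or_gt ‖z - x₀‖ R with h | h
  · nlinarith [mul_nonneg hR.le (abs_nonneg (W z - W x₀))]
  · have hn : 0 < ‖z - x₀‖ := hR.trans h
    set l := R / ‖z - x₀‖ with hl
    have hl0 : 0 < l := by positivity
    have hl1 : l ≤ 1 := (div_le_one hn).2 h.le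
    have hy : l • z + (1 - l) • x₀ ∈ D :=
      hW.1 hz (interior_subset hx₀) hl0.le (by linarith) (by ring)
    have hyn : ‖l • z + (1 - l) • x₀ - x₀‖ = R := by
      have : l • z + (1 - l) • x₀ - x₀ = l • (z - x₀) := by module
      rw [this, norm_smul, Real.norm_of_nonneg hl0.le, hl, div_mul_cancel₀ _ hn.ne']
    have hWy : W x₀ + 1 < W (l • z + (1 - l) • x₀) := by
      by_contra! hle
      exact (hlt _ hy hle).ne hyn
    have h2 := hW.2 hz (interior_subset hx₀) hl0.le (by linarith : 0 ≤ 1 - l) (by ring)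
    simp only [smul_eq_mul] at h2
    have h3 : 1 ≤ l * (W z - W x₀) := by linarith
    have h4 : ‖z - x₀‖ ≤ R * (W z - W x₀) := by
      rw [hl, div_mul_eq_mul_div, le_div_iff₀ hn] at h3
      linarith
    nlinarith [le_abs_self (W z - W x₀)]

end Coercive

section Extended

theorem ConvexEReal.convexOn_toReal {F : Type*} [NormedAddCommGroup F] [InnerProductSpace ℝ F]
    {f : F → EReal} (hf : ConvexEReal f) (hbot : ∀ x, f x ≠ ⊥) :
    ConvexOn ℝ {x | f x ≠ ⊤} fun x => (f x).toReal := by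
  have key : ∀ x, f x ≠ ⊤ → ∀ y, f y ≠ ⊤ → ∀ a b : ℝ, 0 ≤ a → 0 ≤ b → a + b = 1 →
      f (a • x + b • y) ≤ ((a * (f x).toReal + b * (f y).toReal : ℝ) : EReal) := by
    intro x hx y hy a b ha hb hab
    have := hf x y a b ha hb hab
    rw [← EReal.coe_toReal hx (hbot x), ← EReal.coe_toReal hy (hbot y)] at this
    exact_mod_cast this
  refine ⟨fun x hx y hy a b ha hb hab => ?_, fun x hx y hy a b ha hb hab => ?_⟩
  · exact ((key x hx y hy a b ha hb hab).trans_lt (EReal.coe_lt_top _)).ne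
  · have := EReal.toReal_le_toReal (key x hx y hy a b ha hb hab) (hbot _) (EReal.coe_ne_top _)
    rwa [EReal.toReal_coe] at this

theorem IsProperConvexLSC.exists_affine_le {F : Type*} [NormedAddCommGroup F]
    [InnerProductSpace ℝ F] [CompleteSpace F] {f : F → EReal} (hf : IsProperConvexLSC f) :
    ∃ (a : F) (b : ℝ), ∀ x, ((⟪x, a⟫_ℝ + b : ℝ) : EReal) ≤ f x := by
  obtain ⟨hconv, hlsc, hbot, x₁, hx₁⟩ := hf
  set S : Set (F × ℝ) := {p | f p.1 ≤ (p.2 : EReal)} with hS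
  have hSclosed : IsClosed S := by
    have h1 : IsClosed {p : F × EReal | f p.1 ≤ p.2} := hlsc.isClosed_epigraph
    have h2 : Continuous fun p : F × ℝ => (p.1, (p.2 : EReal)) :=
      continuous_fst.prodMk (continuous_coe_real_ereal.comp continuous_snd)
    exact h1.preimage h2
  have hSconv : Convex ℝ S := by
    intro p hp q hq a b ha hb hab
    have hp' : f p.1 ≠ ⊤ := (hp.trans_lt (EReal.coe_lt_top _)).ne
    have hq' : f q.1 ≠ ⊤ := (hq.trans_lt (EReal.coe_lt_top _)).ne
    have h1 := hconv p.1 q.1 a b ha hb hab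
    rw [hS, mem_ofPred_eq] at hp hq ⊢
    rw [← EReal.coe_toReal hp' (hbot _)] at hp h1
    rw [← EReal.coe_toReal hq' (hbot _)] at hq h1
    have hp2 : (f p.1).toReal ≤ p.2 := by exact_mod_cast hp
    have hq2 : (f q.1).toReal ≤ q.2 := by exact_mod_cast hq
    refine h1.trans ?_
    simp only [Prod.snd_add, Prod.smul_snd, smul_eq_mul]
    have : a * (f p.1).toReal + b * (f q.1).toReal ≤ a * p.2 + b * q.2 := by gcongr
    exact_mod_cast this
  set t₁ := (f x₁).toReal with ht₁
  have hx₁t : f x₁ = (t₁ : EReal) := (EReal.coe_toReal hx₁ (hbot _)).symm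
  have hnot : (x₁, t₁ - 1) ∉ S := by
    rw [hS, mem_ofPred_eq, hx₁t, EReal.coe_le_coe_iff]
    linarith
  obtain ⟨l, u, hlS, hlu⟩ := geometric_hahn_banach_closed_point hSconv hSclosed hnot
  have hmem : (x₁, t₁) ∈ S := hx₁t.le
  have hsplit : ∀ (x : F) (t : ℝ), l (x, t) = l (x, 0) + t * l (0, 1) := by
    intro x t
    have : ((x, t) : F × ℝ) = (x, 0) + t • (0, 1) := by simp
    rw [this, map_add, map_smul, smul_eq_mul]
  set s := l (0, 1) with hs
  have hs0 : s < 0 := by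
    have h1 := (hlS _ hmem).trans hlu
    rw [hsplit x₁ t₁, hsplit x₁ (t₁ - 1)] at h1
    linarith
  set a : F := (InnerProductSpace.toDual ℝ F).symm (l.comp (ContinuousLinearMap.inl ℝ F ℝ)) with ha
  have hla : ∀ x : F, l (x, 0) = ⟪x, a⟫_ℝ := by
    intro x
    rw [real_inner_comm, ha, InnerProductSpace.toDual_symm_apply]
    simp
  refine ⟨(-s)⁻¹ • a, -((-s)⁻¹ * u), fun x => ?_⟩
  by_cases hx : f x = ⊤
  · simp [hx]
  have hxt : f x = ((f x).toReal : EReal) := (EReal.coe_toReal hx (hbot _)).symm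
  have h1 := hlS (x, (f x).toReal) hxt.le
  rw [hsplit, hla] at h1
  rw [hxt, EReal.coe_le_coe_iff, real_inner_smul_right, ← sub_eq_add_neg, ← mul_sub,
    inv_mul_le_iff₀ (by linarith)]
  linarith

section Integral

variable {α : Type*} [MeasurableSpace α] {μ : Measure α}

@[simp]
theorem ERealPos_coe (r : ℝ) : ERealPos (r : EReal) = ENNReal.ofReal r := by
  simp [ERealPos]

theorem measurable_ERealPos : Measurable ERealPos :=
  Measurable.ite (measurableSet_singleton ⊤) measurable_const
    (ENNReal.measurable_ofReal.comp measurable_ereal_toReal)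

theorem eintegral_congr_ae {g h : α → EReal} (hgh : g =ᵐ[μ] h) :
    eintegral μ g = eintegral μ h := by
  have h1 : ∫⁻ x, ERealPos (g x) ∂μ = ∫⁻ x, ERealPos (h x) ∂μ :=
    lintegral_congr_ae (hgh.mono fun x hx => by simp only [hx])
  have h2 : ∫⁻ x, ERealPos (-g x) ∂μ = ∫⁻ x, ERealPos (-h x) ∂μ :=
    lintegral_congr_ae (hgh.mono fun x hx => by simp only [hx])
  rw [eintegral, eintegral, h1, h2]

theorem eintegral_coe {r : α → ℝ} (hr : Integrable r μ) :
    eintegral μ (fun x => (r x : EReal)) = ((∫ x, r x ∂μ : ℝ) : EReal) := by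
  have hp : ∫⁻ x, ENNReal.ofReal (r x) ∂μ ≠ ∞ := hr.lintegral_lt_top.ne
  have hn : ∫⁻ x, ENNReal.ofReal (-r x) ∂μ ≠ ∞ := hr.neg.lintegral_lt_top.ne
  rw [integral_eq_lintegral_pos_part_sub_lintegral_neg_part hr, EReal.coe_sub,
    EReal.coe_ennreal_toReal hp, EReal.coe_ennreal_toReal hn, eintegral]
  simp only [← EReal.coe_neg, ERealPos_coe]

theorem eintegral_map {β : Type*} [MeasurableSpace β] {T : α → β} (hT : Measurable T)
    {g : β → EReal} (hg : Measurable g) :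
    eintegral (μ.map T) g = eintegral μ fun x => g (T x) := by
  rw [eintegral, eintegral,
    lintegral_map (f := fun x => ERealPos (g x)) (measurable_ERealPos.comp hg) hT,
    lintegral_map (f := fun x => ERealPos (-g x)) (measurable_ERealPos.comp hg.neg) hT]

theorem lintegral_ERealPos_neg_ne_top {g : α → EReal} {r : α → ℝ} (hr : Integrable r μ)
    (hrg : ∀ᵐ x ∂μ, (r x : EReal) ≤ g x) : ∫⁻ x, ERealPos (-g x) ∂μ ≠ ∞ := by
  refine ne_top_of_le_ne_top hr.neg.lintegral_lt_top.ne (lintegral_mono_ae ?_)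
  filter_upwards [hrg] with x hx
  induction hgx : g x with
  | bot => simp [hgx] at hx
  | top => simp [ERealPos]
  | coe t =>
    rw [hgx, EReal.coe_le_coe_iff] at hx
    rw [← EReal.coe_neg, ERealPos_coe]
    exact ENNReal.ofReal_le_ofReal (neg_le_neg hx)

/-- An extended-real function bounded below by an integrable one either has integral `⊤` or is
almost everywhere equal to an integrable real function. -/
theorem eintegral_eq_top_or {g : α → EReal} (hg : Measurable g) {r : α → ℝ} (hr : Integrable r μ)
    (hrg : ∀ᵐ x ∂μ, (r x : EReal) ≤ g x) :
    eintegral μ g = ⊤ ∨ Integrable (fun x => (g x).toReal) μ ∧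
      g =ᵐ[μ] fun x => ((g x).toReal : EReal) := by
  have hn := lintegral_ERealPos_neg_ne_top hr hrg
  by_cases hp : ∫⁻ x, ERealPos (g x) ∂μ = ∞
  · left
    rw [eintegral, hp]
    lift ∫⁻ x, ERealPos (-g x) ∂μ to NNReal using hn with N
    rfl
  · right
    have hfin : g =ᵐ[μ] fun x => ((g x).toReal : EReal) := by
      filter_upwards [ae_lt_top (measurable_ERealPos.comp hg) hp, hrg] with x hx hrx
      refine (EReal.coe_toReal ?_ ?_).symm
      · intro h
        simp [ERealPos, h] at hx
      · intro h
        simp [h] at hrx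
    refine ⟨⟨hg.ereal_toReal.aestronglyMeasurable, ?_⟩, hfin⟩
    have hle : ∀ᵐ x ∂μ, ‖(g x).toReal‖ₑ ≤ ERealPos (g x) + ERealPos (-g x) := by
      filter_upwards [hfin] with x hx
      rw [hx, ← EReal.coe_neg, ERealPos_coe, ERealPos_coe, EReal.toReal_coe,
        Real.enorm_eq_ofReal_abs]
      rcases le_total 0 (g x).toReal with h | h
      · rw [abs_of_nonneg h]; exact le_self_add
      · rw [abs_of_nonpos h]; exact le_add_self
    refine (lintegral_mono_ae hle).trans_lt ?_
    rw [lintegral_add_left (f := fun x => ERealPos (g x)) (measurable_ERealPos.comp hg)]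
    exact ENNReal.add_lt_top.2 ⟨lt_top_iff_ne_top.2 hp, lt_top_iff_ne_top.2 hn⟩

end Integral

section Fenchel

variable {F : Type*} [NormedAddCommGroup F] [InnerProductSpace ℝ F] {f : F → EReal}

theorem sub_le_fenchel (f : F → EReal) (x y : F) : (⟪x, y⟫_ℝ : EReal) - f x ≤ fenchel f y :=
  le_iSup (fun x : F => (⟪x, y⟫_ℝ : EReal) - f x) x

theorem lowerSemicontinuous_fenchel (hbot : ∀ x, f x ≠ ⊥) : LowerSemicontinuous (fenchel f) := by
  refine lowerSemicontinuous_iSup fun x => Continuous.lowerSemicontinuous ?_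
  by_cases hx : f x = ⊤
  · simpa [hx] using continuous_const
  · rw [← EReal.coe_toReal hx (hbot x)]
    exact continuous_coe_real_ereal.comp (by fun_prop : Continuous fun y : F =>
      ⟪x, y⟫_ℝ - (f x).toReal)

end Fenchel

end Extended

section Virial

variable {F : Type*} [NormedAddCommGroup F] [InnerProductSpace ℝ F] [FiniteDimensional ℝ F]
  [MeasurableSpace F] [BorelSpace F]

theorem lintegral_radial_sub {D : Set F} {W φ : F → ℝ} (hW : ConvexOn ℝ D W)
    (hφD : ∀ z ∈ D, φ z = Real.exp (-W z)) (hφ0 : ∀ z, z ∉ D → φ z = 0)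
    (hφ : UpperSemicontinuous φ) {x₀ : F} (hx₀ : x₀ ∈ interior D) {M : ℕ} (hM1 : 1 ≤ M)
    (hM : ∀ z ∈ D, W x₀ - M ≤ W z) {g : F → F} (hgm : Measurable g)
    (hb : ∀ᵐ x : F, ∀ u : ℝ, 0 < u → u • x + x₀ ∉ interior D → φ (u • x + x₀) = 0)
    (hg : ∀ᵐ z : F, z ∈ interior D → HasGradientAt W (g z) z)
    (hfin : ∫⁻ x, ENNReal.ofReal (φ x) ≠ ∞) :
    ∫⁻ x, ENNReal.ofReal ((⟪x - x₀, g x⟫_ℝ + M) * φ x) =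
      ENNReal.ofReal (Module.finrank ℝ F + M) * ∫⁻ x, ENNReal.ofReal (φ x) := by
  have h_int : interior ((fun z => z + x₀) ⁻¹' D) = (fun z => z + x₀) ⁻¹' interior D :=
    ((Homeomorph.addRight x₀).preimage_interior D).symm
  have hWt : ConvexOn ℝ ((fun z => z + x₀) ⁻¹' D) (fun z => W (z + x₀)) :=
    hW.translate_right x₀ |> fun h => by simpa [add_comm, Function.comp_def] using h
  have hgt : ∀ᵐ z : F, z ∈ interior ((fun z => z + x₀) ⁻¹' D) →
      HasGradientAt (fun z => W (z + x₀)) (g (z + x₀)) z := by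
    rw [h_int]
    have := (measurePreserving_add_right (volume : Measure F) x₀).quasiMeasurePreserving.ae hg
    filter_upwards [this] with z hz hzD
    have h1 := (hz hzD).hasFDerivAt
    have h2 : HasFDerivAt (fun z => z + x₀) (ContinuousLinearMap.id ℝ F) z :=
      (hasFDerivAt_id z).add_const x₀
    have h3 := h1.comp z h2
    rw [ContinuousLinearMap.comp_id] at h3
    exact hasGradientAt_iff_hasFDerivAt.2 h3
  have key := lintegral_radial hWt (φ := fun z => φ (z + x₀)) (fun z hz => hφD _ hz)
    (fun z hz => hφ0 _ hz) (hφ.comp (by fun_prop)) (by rw [h_int]; simpa using hx₀) hM1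
    (fun z hz => by simpa using hM _ hz) (hgm.comp (measurable_add_const x₀))
    (by rw [h_int]; exact hb) hgt
    (by rw [lintegral_add_right_eq_self (fun x => ENNReal.ofReal (φ x)) x₀]; exact hfin)
  rw [lintegral_add_right_eq_self (fun x => ENNReal.ofReal (φ x)) x₀] at key
  rw [← key, ← lintegral_add_right_eq_self _ x₀]
  simp

theorem integral_inner_sub_gradient {D : Set F} {W φ : F → ℝ} (hW : ConvexOn ℝ D W)
    (hφD : ∀ z ∈ D, φ z = Real.exp (-W z)) (hφ0 : ∀ z, z ∉ D → φ z = 0)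
    (hφ : UpperSemicontinuous φ) {x₀ : F} (hx₀ : x₀ ∈ interior D) {g : F → F}
    (hgm : Measurable g)
    (hb : ∀ᵐ x : F, ∀ u : ℝ, 0 < u → u • x + x₀ ∉ interior D → φ (u • x + x₀) = 0)
    (hg : ∀ᵐ z : F, z ∈ D → HasGradientAt W (g z) z)
    (hone : ∫⁻ x, ENNReal.ofReal (φ x) = 1) :
    Integrable (fun x => ⟪x - x₀, g x⟫_ℝ * φ x) ∧
      ∫ x, ⟪x - x₀, g x⟫_ℝ * φ x = Module.finrank ℝ F := by
  have hfin : ∫⁻ x, ENNReal.ofReal (φ x) ≠ ∞ := by simp [hone]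
  have hφnn : ∀ x, 0 ≤ φ x := fun x => by
    by_cases hx : x ∈ D
    · rw [hφD x hx]; positivity
    · rw [hφ0 x hx]
  have hφm : Measurable φ := hφ.measurable
  obtain ⟨m, hm⟩ := hW.exists_le_of_lintegral_exp hφD hfin hx₀
  obtain ⟨N, hN⟩ := exists_nat_ge (W x₀ - m)
  have hM : ∀ z ∈ D, W x₀ - (N + 1 : ℕ) ≤ W z := fun z hz => by
    have := hm z hz
    push_cast
    linarith
  have key := lintegral_radial_sub hW hφD hφ0 hφ hx₀ (M := N + 1) (by lia) hM hgm hb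
    (hg.mono fun z hz h => hz (interior_subset h)) hfin
  rw [hone, mul_one] at key
  have hnn : 0 ≤ᵐ[volume] fun x => (⟪x - x₀, g x⟫_ℝ + (N + 1 : ℕ)) * φ x := by
    filter_upwards [hg] with x hx
    by_cases hxD : x ∈ D
    · refine mul_nonneg ?_ (hφnn x)
      have h1 := hW.inner_gradient_le hxD (interior_subset hx₀) (hx hxD)
      have h2 := hM x hxD
      rw [← neg_sub x x₀, inner_neg_left] at h1
      linarith
    · simp [hφ0 x hxD]
  have hmeas : Measurable fun x => (⟪x - x₀, g x⟫_ℝ + (N + 1 : ℕ)) * φ x := by fun_prop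
  have hI : Integrable fun x => (⟪x - x₀, g x⟫_ℝ + (N + 1 : ℕ)) * φ x :=
    (lintegral_ofReal_ne_top_iff_integrable hmeas.aestronglyMeasurable hnn).1 (by rw [key]; simp)
  have hφI : Integrable φ :=
    (lintegral_ofReal_ne_top_iff_integrable hφm.aestronglyMeasurable (ae_of_all _ hφnn)).1 hfin
  have hφone : ∫ x, φ x = 1 := by
    rw [integral_eq_lintegral_of_nonneg_ae (ae_of_all _ hφnn) hφm.aestronglyMeasurable, hone]
    simp
  have hval : ∫ x, (⟪x - x₀, g x⟫_ℝ + (N + 1 : ℕ)) * φ x = Module.finrank ℝ F + (N + 1 : ℕ) := by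
    rw [integral_eq_lintegral_of_nonneg_ae hnn hmeas.aestronglyMeasurable, key,
      ENNReal.toReal_ofReal (by positivity)]
  have heq : (fun x => ⟪x - x₀, g x⟫_ℝ * φ x) =
      fun x => (⟪x - x₀, g x⟫_ℝ + (N + 1 : ℕ)) * φ x - (N + 1 : ℕ) * φ x := by
    funext x
    ring
  rw [heq]
  refine ⟨hI.sub (hφI.const_mul _), ?_⟩
  rw [integral_sub hI (hφI.const_mul _), hval, integral_const_mul, hφone]
  ring

theorem integral_inner_gradient {D : Set F} {W φ : F → ℝ} (hW : ConvexOn ℝ D W)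
    (hφD : ∀ z ∈ D, φ z = Real.exp (-W z)) (hφ0 : ∀ z, z ∉ D → φ z = 0)
    (hφ : UpperSemicontinuous φ) (hD : (interior D).Nonempty) {g : F → F}
    (hgm : Measurable g)
    (hb : ∀ x₀ ∈ interior D, ∀ᵐ x : F, ∀ u : ℝ, 0 < u → u • x + x₀ ∉ interior D →
      φ (u • x + x₀) = 0)
    (hg : ∀ᵐ z : F, z ∈ D → HasGradientAt W (g z) z)
    (hone : ∫⁻ x, ENNReal.ofReal (φ x) = 1) :
    (∀ v : F, Integrable fun x => ⟪v, g x⟫_ℝ * φ x) ∧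
      Integrable (fun x => ⟪x, g x⟫_ℝ * φ x) ∧
        ∫ x, ⟪x, g x⟫_ℝ * φ x = Module.finrank ℝ F := by
  obtain ⟨x₀, hx₀⟩ := hD
  have base := fun y hy => integral_inner_sub_gradient hW hφD hφ0 hφ hy hgm (hb y hy) hg hone
  have hv : ∀ v : F, (Integrable fun x => ⟪v, g x⟫_ℝ * φ x) ∧ ∫ x, ⟪v, g x⟫_ℝ * φ x = 0 := by
    intro v
    obtain ⟨ε, hε, hy⟩ : ∃ ε : ℝ, 0 < ε ∧ x₀ + ε • v ∈ interior D := by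
      have hc : Filter.Tendsto (fun ε : ℝ => x₀ + ε • v) (nhdsWithin 0 (Ioi 0)) (nhds x₀) := by
        have : Continuous fun ε : ℝ => x₀ + ε • v := by fun_prop
        simpa using (this.tendsto 0).mono_left nhdsWithin_le_nhds
      obtain ⟨ε, h1, h2⟩ := ((hc.eventually (isOpen_interior.mem_nhds hx₀)).and
        self_mem_nhdsWithin).exists
      exact ⟨ε, h2, h1⟩
    have heq : (fun x => ⟪v, g x⟫_ℝ * φ x) = fun x =>
        ε⁻¹ * (⟪x - x₀, g x⟫_ℝ * φ x - ⟪x - (x₀ + ε • v), g x⟫_ℝ * φ x) := by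
      funext x
      rw [← sub_sub, inner_sub_left (x - x₀), inner_smul_left]
      simp only [conj_trivial]
      field_simp
      ring
    rw [heq]
    refine ⟨((base x₀ hx₀).1.sub (base _ hy).1).const_mul _, ?_⟩
    rw [integral_const_mul, integral_sub (base x₀ hx₀).1 (base _ hy).1, (base x₀ hx₀).2,
      (base _ hy).2, sub_self, mul_zero]
  refine ⟨fun v => (hv v).1, ?_⟩
  have heq : (fun x => ⟪x, g x⟫_ℝ * φ x) = fun x =>
      ⟪x - x₀, g x⟫_ℝ * φ x + ⟪x₀, g x⟫_ℝ * φ x := by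
    funext x
    rw [inner_sub_left]
    ring
  rw [heq]
  refine ⟨(base x₀ hx₀).1.add (hv x₀).1, ?_⟩
  rw [integral_add (base x₀ hx₀).1 (hv x₀).1, (base x₀ hx₀).2, (hv x₀).2, add_zero]

end Virial

section Transport

variable {F : Type*} [NormedAddCommGroup F] [InnerProductSpace ℝ F] [FiniteDimensional ℝ F]

theorem fenchel_eq_of_hasGradientAt {V : F → EReal} (hV : ConvexEReal V) (hbot : ∀ x, V x ≠ ⊥)
    {x g : F} (hx : V x ≠ ⊤) (hg : HasGradientAt (fun y => (V y).toReal) g x) :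
    fenchel V g = ((⟪x, g⟫_ℝ - (V x).toReal : ℝ) : EReal) := by
  refine le_antisymm (iSup_le fun z => ?_) ?_
  · by_cases hz : V z = ⊤
    · simp [hz]
    · have := (hV.convexOn_toReal hbot).inner_gradient_le hx hz hg
      rw [inner_sub_left] at this
      rw [← EReal.coe_toReal hz (hbot z), ← EReal.coe_sub, EReal.coe_le_coe_iff]
      linarith
  · have := sub_le_fenchel V x g
    rw [← EReal.coe_toReal hx (hbot x)] at this
    exact_mod_cast this

variable [MeasurableSpace F] [BorelSpace F] {μ : Measure F} [IsProbabilityMeasure μ] {T : F → F}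

theorem integral_inner_le_eintegral_add (hT : Measurable T)
    (hmom : ∀ a, Integrable (fun x => ⟪x, a⟫_ℝ) μ) (hTmom : ∀ v, Integrable (fun x => ⟪v, T x⟫_ℝ) μ)
    (hTI : Integrable (fun x => ⟪x, T x⟫_ℝ) μ) {f : F → EReal} (hf : IsProperConvexLSC f) :
    ((∫ x, ⟪x, T x⟫_ℝ ∂μ : ℝ) : EReal) ≤ eintegral μ f + eintegral (μ.map T) (fenchel f) := by
  obtain ⟨a, b, hab⟩ := hf.exists_affine_le
  obtain ⟨-, hlsc, hbot, x₁, hx₁⟩ := hf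
  have hfen := (lowerSemicontinuous_fenchel hbot).measurable
  rw [eintegral_map hT hfen]
  have h1 := eintegral_eq_top_or hlsc.measurable ((hmom a).add (integrable_const b))
    (ae_of_all μ hab)
  have h2 : eintegral μ (fun x => fenchel f (T x)) = ⊤ ∨ _ :=
    eintegral_eq_top_or (hfen.comp hT)
      ((hTmom x₁).sub (integrable_const (f x₁).toReal)) (ae_of_all μ fun x => by
        have := sub_le_fenchel f x₁ (T x)
        rw [← EReal.coe_toReal hx₁ (hbot x₁)] at this
        exact_mod_cast this)
  rcases h1 with h1 | ⟨h1I, h1e⟩ <;> rcases h2 with h2 | ⟨h2I, h2e⟩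
  · simp [h1, h2]
  · rw [h1, eintegral_congr_ae h2e, eintegral_coe h2I]
    simp
  · rw [h2, eintegral_congr_ae h1e, eintegral_coe h1I]
    simp
  · rw [eintegral_congr_ae h1e, eintegral_coe h1I, eintegral_congr_ae h2e, eintegral_coe h2I,
      ← EReal.coe_add, EReal.coe_le_coe_iff, ← integral_add h1I h2I]
    refine integral_mono_ae hTI (h1I.add h2I) ?_
    filter_upwards [h1e, h2e] with x hx1 hx2
    have := sub_le_fenchel f x (T x)
    rw [hx1, hx2, ← EReal.coe_sub, EReal.coe_le_coe_iff] at this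
    linarith

theorem mcCost_map_eq_integral (hT : Measurable T)
    (hmom : ∀ a, Integrable (fun x => ⟪x, a⟫_ℝ) μ) (hTmom : ∀ v, Integrable (fun x => ⟪v, T x⟫_ℝ) μ)
    (hTI : Integrable (fun x => ⟪x, T x⟫_ℝ) μ) {f : F → EReal} (hf : IsProperConvexLSC f)
    (hfI : MemL1 μ f)
    (hopt : ∀ᵐ x ∂μ, fenchel f (T x) = ((⟪x, T x⟫_ℝ - (f x).toReal : ℝ) : EReal)) :
    mcCost μ (μ.map T) = ((∫ x, ⟪x, T x⟫_ℝ ∂μ : ℝ) : EReal) := by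
  refine le_antisymm ?_ (le_iInf fun h => integral_inner_le_eintegral_add hT hmom hTmom hTI h.2)
  refine (iInf_le _ ⟨f, hf⟩).trans ?_
  have hfe : f =ᵐ[μ] fun x => ((f x).toReal : EReal) := by
    filter_upwards [hfI.1] with x hx
    exact (EReal.coe_toReal hx.1 hx.2).symm
  rw [eintegral_map hT (lowerSemicontinuous_fenchel hf.2.2.1).measurable, eintegral_congr_ae hopt,
    eintegral_coe (r := fun x => ⟪x, T x⟫_ℝ - (f x).toReal) (hTI.sub hfI.2),
    eintegral_congr_ae hfe, eintegral_coe hfI.2,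
    ← EReal.coe_add, integral_sub hTI hfI.2]
  simp

end Transport

section MomentMeasure

theorem expNeg_nonneg (t : EReal) : 0 ≤ expNeg t := by
  unfold expNeg
  split_ifs <;> positivity

theorem expNeg_of_ne {t : EReal} (ht : t ≠ ⊤) (hb : t ≠ ⊥) : expNeg t = Real.exp (-t.toReal) := by
  simp [expNeg, ht, hb]

theorem upperSemicontinuous_expNeg_comp {X : Type*} [TopologicalSpace X] {V : X → EReal}
    (hV : LowerSemicontinuous V) (hbot : ∀ x, V x ≠ ⊥) :
    UpperSemicontinuous fun x => expNeg (V x) := by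
  rw [upperSemicontinuous_iff_isClosed_preimage]
  intro c
  rcases le_or_gt c 0 with hc | hc
  · convert isClosed_univ
    exact eq_univ_of_forall fun x => hc.trans (expNeg_nonneg _)
  · convert lowerSemicontinuous_iff_isClosed_preimage.1 hV ((-Real.log c : ℝ) : EReal)
    ext x
    simp only [mem_preimage, mem_Ici, mem_Iic]
    by_cases hx : V x = ⊤
    · simp [hx, expNeg, hc]
    · rw [expNeg_of_ne hx (hbot x), ← Real.log_le_iff_le_exp hc]
      conv_rhs => rw [← EReal.coe_toReal hx (hbot x)]
      rw [EReal.coe_le_coe_iff]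
      constructor <;> intro h <;> linarith

theorem Convex.nonempty_interior_of_volume_ne_zero {F : Type*} [NormedAddCommGroup F]
    [InnerProductSpace ℝ F] [FiniteDimensional ℝ F] [MeasurableSpace F] [BorelSpace F] {D : Set F}
    (hD : Convex ℝ D) (h : volume D ≠ 0) : (interior D).Nonempty := by
  by_contra hne
  rw [not_nonempty_iff_eq_empty] at hne
  refine h (measure_mono_null ?_ (hD.addHaar_frontier volume))
  rw [frontier, hne, sdiff_empty]
  exact subset_closure

theorem ae_forall_smul_add_eq_zero {n : ℕ} {D : Set (EuclideanSpace ℝ (Fin n))} (hD : Convex ℝ D)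
    {φ : EuclideanSpace ℝ (Fin n) → ℝ} (hφ0 : ∀ z, z ∉ D → φ z = 0)
    (hEC : μH[(n : ℝ) - 1] {x | x ∈ frontier (closure D) ∧ φ x ≠ 0} = 0)
    {x₀ : EuclideanSpace ℝ (Fin n)} (hx₀ : x₀ ∈ interior D) :
    ∀ᵐ x : EuclideanSpace ℝ (Fin n), ∀ u : ℝ, 0 < u → u • x + x₀ ∉ interior D →
      φ (u • x + x₀) = 0 := by
  cases n with
  | zero =>
    refine ae_of_all _ fun x u _ hu => absurd ?_ hu
    rwa [Subsingleton.elim (u • x + x₀) x₀]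
  | succ m =>
    have hsub : ∀ y, y ∉ interior D → φ y ≠ 0 → y ∈ {x | x ∈ frontier (closure D) ∧ φ x ≠ 0} := by
      refine fun y hy hφy => ⟨?_, hφy⟩
      rw [frontier, hD.interior_closure_eq_interior_of_nonempty_interior ⟨x₀, hx₀⟩, closure_closure]
      refine ⟨subset_closure ?_, hy⟩
      by_contra h
      exact hφy (hφ0 y h)
    have hB : μH[m] ((fun z => z + x₀) ⁻¹' {x | x ∈ frontier (closure D) ∧ φ x ≠ 0}) = 0 := by
      have := (IsometryEquiv.addRight x₀).hausdorffMeasure_preimage m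
        {x | x ∈ frontier (closure D) ∧ φ x ≠ 0}
      refine Eq.trans this ?_
      rw [← hEC]
      congr 2
      push_cast
      ring
    filter_upwards [ae_forall_smul_notMem hB] with x hx u hu hnot
    by_contra h
    exact hx u hu (hsub _ hnot h)

end MomentMeasure

/-- Lemma A.1. Let `η` be a log-concave probability measure on `ℝⁿ`
with potential `V` and an essentially continuous density (i.e. `e^{-V}` vanishes
`H_{n-1}`-a.e. on the boundary of the support of `η`), and let `ν = ∇V # η` be its moment
measure. Then `𝒯(η, ν) = ∫ x·∇V(x) e^{-V(x)} dx = n`. -/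
theorem statement19 {n : ℕ} (V : EuclideanSpace ℝ (Fin n) → EReal)
    (hVconv : ConvexEReal V) (hVlsc : LowerSemicontinuous V) (hVbot : ∀ x, V x ≠ ⊥)
    (η : Measure (EuclideanSpace ℝ (Fin n)))
    (hη : η = volume.withDensity (fun x => ENNReal.ofReal (expNeg (V x))))
    (hηprob : IsProbabilityMeasure η)
    (hEC : μH[(n : ℝ) - 1]
        {x | x ∈ frontier (closure {y : EuclideanSpace ℝ (Fin n) | V y ≠ ⊤})
          ∧ expNeg (V x) ≠ 0} = 0)
    (gV : EuclideanSpace ℝ (Fin n) → EuclideanSpace ℝ (Fin n)) (hgVmeas : Measurable gV)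
    (hgrad : ∀ᵐ x ∂η, HasGradientAt (fun y => (V y).toReal) (gV x) x)
    (ν : Measure (EuclideanSpace ℝ (Fin n))) (hν : ν = Measure.map gV η) :
    mcCost η ν
        = eintegral volume (fun x => ((⟪x, gV x⟫_ℝ * expNeg (V x) : ℝ) : EReal)) ∧
      mcCost η ν = ((n : ℝ) : EReal) := by
  set D : Set (EuclideanSpace ℝ (Fin n)) := {x | V x ≠ ⊤} with hDdef
  have hW : ConvexOn ℝ D fun x => (V x).toReal := hVconv.convexOn_toReal hVbot
  have hφD : ∀ z ∈ D, expNeg (V z) = Real.exp (-(V z).toReal) := fun z hz =>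
    expNeg_of_ne hz (hVbot z)
  have hφ0 : ∀ z, z ∉ D → expNeg (V z) = 0 := fun z hz => by
    have : V z = ⊤ := by simpa [hDdef] using hz
    simp [expNeg, this]
  have hφ := upperSemicontinuous_expNeg_comp hVlsc hVbot
  have hφm : Measurable fun x => ENNReal.ofReal (expNeg (V x)) := hφ.measurable.ennreal_ofReal
  have hφpos : ∀ x, ENNReal.ofReal (expNeg (V x)) ≠ 0 ↔ x ∈ D := fun x => by
    by_cases hx : x ∈ D
    · simp [hx, hφD x hx, Real.exp_pos]
    · simp [hx, hφ0 x hx]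
  have hone : ∫⁻ x, ENNReal.ofReal (expNeg (V x)) = 1 := by
    have := hηprob.measure_univ
    rwa [hη, withDensity_apply _ MeasurableSet.univ, Measure.restrict_univ] at this
  have hηD : ∀ᵐ x ∂η, x ∈ D := by
    rw [hη, ae_withDensity_iff hφm]
    exact ae_of_all _ fun x hx => (hφpos x).1 hx
  have hgvol : ∀ᵐ x, x ∈ D → HasGradientAt (fun y => (V y).toReal) (gV x) x := by
    rw [hη, ae_withDensity_iff hφm] at hgrad
    filter_upwards [hgrad] with x hx hxD using hx ((hφpos x).2 hxD)
  have h_int : (interior D).Nonempty := by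
    refine hW.1.nonempty_interior_of_volume_ne_zero fun h => ?_
    have : η D = 0 := by rw [hη]; exact withDensity_absolutelyContinuous _ _ h
    obtain ⟨x, hx, hx'⟩ := (hηD.and (measure_eq_zero_iff_ae_notMem.1 this)).exists
    exact hx' hx
  obtain ⟨hvI, hxI, hxV⟩ := integral_inner_gradient hW hφD hφ0 hφ h_int hgVmeas
    (fun x₀ hx₀ => ae_forall_smul_add_eq_zero hW.1 hφ0 hEC hx₀) hgvol hone
  obtain ⟨x₀, hx₀⟩ := h_int
  rw [finrank_euclideanSpace_fin] at hxV
  have hηI : ∀ h : EuclideanSpace ℝ (Fin n) → ℝ,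
      Integrable h η ↔ Integrable fun x => h x * expNeg (V x) := fun h => by
    rw [hη, integrable_withDensity_iff hφm (by simp)]
    simp only [ENNReal.toReal_ofReal (expNeg_nonneg _)]
  have hTmom : ∀ v, Integrable (fun x => ⟪v, gV x⟫_ℝ) η := fun v => (hηI _).2 (hvI v)
  have hTI : Integrable (fun x => ⟪x, gV x⟫_ℝ) η := (hηI _).2 hxI
  have hTval : ∫ x, ⟪x, gV x⟫_ℝ ∂η = n := by
    rw [hη, integral_withDensity_eq_integral_toReal_smul hφm (by simp), ← hxV]
    simp only [ENNReal.toReal_ofReal (expNeg_nonneg _), smul_eq_mul, mul_comm]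
  have hfin : ∫⁻ x, ENNReal.ofReal (expNeg (V x)) ≠ ∞ := by simp [hone]
  have hVm : Measurable fun x => (V x).toReal := measurable_ereal_toReal.comp hVlsc.measurable
  have hVI : Integrable (fun x => (V x).toReal) η := by
    obtain ⟨m, hm⟩ := hW.exists_le_of_lintegral_exp hφD hfin hx₀
    refine integrable_of_le_of_le hVm.aestronglyMeasurable
      (g₁ := fun _ => m) (g₂ := fun x => (V x₀).toReal + (⟪x, gV x⟫_ℝ - ⟪x₀, gV x⟫_ℝ))
      (hηD.mono fun x hx => hm x hx) ?_ (integrable_const _)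
      ((integrable_const _).add (hTI.sub (hTmom x₀)))
    filter_upwards [hηD, hgrad] with x hx hg
    have := hW.inner_gradient_le hx (interior_subset hx₀) hg
    rw [inner_sub_left] at this
    linarith
  have hmom : ∀ a, Integrable (fun x => ⟪x, a⟫_ℝ) η := by
    obtain ⟨R, -, hbd⟩ := hW.exists_norm_le_of_lintegral_exp hφD hfin hx₀
    intro a
    refine Integrable.mono' (g := fun x => (R * (1 + |(V x).toReal - (V x₀).toReal|) + ‖x₀‖) * ‖a‖)
      (((((integrable_const _).add (hVI.sub (integrable_const _)).abs).const_mul R).add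
        (integrable_const _)).mul_const _) (by fun_prop) ?_
    filter_upwards [hηD] with x hx
    refine (norm_inner_le_norm _ _).trans ?_
    gcongr
    have h1 := hbd x hx
    have h2 := norm_le_norm_sub_add x x₀
    linarith
  have hcost : mcCost η ν = ((n : ℝ) : EReal) := by
    rw [hν, mcCost_map_eq_integral hgVmeas hmom hTmom hTI
      ⟨hVconv, hVlsc, hVbot, x₀, interior_subset hx₀⟩
      ⟨hηD.mono fun x hx => ⟨hx, hVbot x⟩, hVI⟩ ?_, hTval]
    filter_upwards [hηD, hgrad] with x hx hg using fenchel_eq_of_hasGradientAt hVconv hVbot hx hg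
  exact ⟨by rw [hcost, eintegral_coe hxI, hxV], hcost⟩

end
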